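/- arXiv:1506.01401 — 7 statements merged into one kernel-verified Lean document; each statement's English description precedes it below -/
import Mathlib

section
/- For every real a > 0 and every complex s with Re(s) > 3, the series Σ_{n=1}^∞ 2n(n+1)·((n+1/2)/a)^{-s} converges absolutely and equals a^s·(2·ζ_H(s-2, 3/2) − (1/2)·ζ_H(s, 3/2)). (This is the zeta function Tr(|D_{S³_a}|^{-s}) of the Dirac operator on the round 3-sphere of radius a.) -/
open Complex

/-- The Hurwitz zeta function `ζ_H(s, 3/2)`: the meromorphic continuation in `s` of
`Σ_{n≥0} (n + 3/2)^{-s}`, obtained from Mathlib's `hurwitzZeta (1/2) s` (continuation of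
`Σ_{n≥0} (n + 1/2)^{-s}`) by removing the `n = 0` term `(1/2)^{-s} = 2^s`. -/
noncomputable def hurwitzZeta32 (s : ℂ) : ℂ :=
  HurwitzZeta.hurwitzZeta ((1 / 2 : ℝ) : UnitAddCircle) s - 2 ^ s

lemma hz32_hasSum (s : ℂ) (hs : 1 < s.re) :
    HasSum (fun n : ℕ => (((n : ℂ) + 1 + 1 / 2)) ^ (-s)) (hurwitzZeta32 s) := by
  have h := HurwitzZeta.hasSum_hurwitzZeta_of_one_lt_re (a := 1 / 2)
    ⟨by norm_num, by norm_num⟩ hs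
  rw [← hasSum_nat_add_iff' 1] at h
  have e : (1 : ℂ) / 2 = (2 : ℂ)⁻¹ := by norm_num
  have e2 : ((2 : ℂ)⁻¹ ^ s)⁻¹ = 2 ^ s := by
    rw [Complex.inv_cpow, inv_inv]
    have : (2 : ℂ) = ((2 : ℝ) : ℂ) := by norm_num
    rw [this, Complex.arg_ofReal_of_nonneg (by norm_num)]
    exact Real.pi_pos.ne
  unfold hurwitzZeta32
  convert! h using 1
  · funext n
    rw [Complex.cpow_neg]
    push_cast
    rw [one_div (_ ^ s)]
  · simp [e2]

lemma term_eq (a : ℝ) (ha : 0 < a) (s : ℂ) (n : ℕ) :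
    (2 * ((n : ℂ) + 1) * ((n : ℂ) + 1 + 1)) * (((((n : ℝ) + 1) + 1 / 2) / a : ℝ) : ℂ) ^ (-s)
    = (a : ℂ) ^ s * (2 * ((n : ℂ) + 1 + 1 / 2) ^ (-(s - 2))
      - (1 / 2) * ((n : ℂ) + 1 + 1 / 2) ^ (-s)) := by
  have hx : (0 : ℝ) < (n : ℝ) + 1 + 1 / 2 := by positivity
  have hc : ((n : ℂ) + 1 + 1 / 2) = (((n : ℝ) + 1 + 1 / 2 : ℝ) : ℂ) := by push_cast; rfl
  have hx0 : ((n : ℂ) + 1 + 1 / 2) ≠ 0 := by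
    rw [hc]; exact_mod_cast hx.ne'
  have h1 : ((n : ℂ) + 1 + 1 / 2) ^ (-(s - 2))
      = ((n : ℂ) + 1 + 1 / 2) ^ (-s) * ((n : ℂ) + 1 + 1 / 2) ^ 2 := by
    rw [show -(s - 2) = -s + (2 : ℕ) by push_cast; ring, Complex.cpow_add _ _ hx0,
      Complex.cpow_natCast]
  have h2 : (((((n : ℝ) + 1) + 1 / 2) / a : ℝ) : ℂ) ^ (-s)
      = ((n : ℂ) + 1 + 1 / 2) ^ (-s) * (a : ℂ) ^ s := by
    rw [div_eq_mul_inv, Complex.ofReal_mul, Complex.mul_cpow_ofReal_nonneg hx.le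
      (inv_pos.mpr ha).le, ← hc, Complex.ofReal_inv, Complex.inv_cpow, Complex.cpow_neg (a : ℂ),
      inv_inv]
    rw [Complex.arg_ofReal_of_nonneg ha.le]
    exact Real.pi_pos.ne
  rw [h1, h2]
  ring

/-- The zeta function of the Dirac operator on the round 3-sphere of radius `a > 0`:
for `Re s > 3`, `Σ_{n≥1} 2n(n+1)·((n+1/2)/a)^{-s}` converges absolutely with sum
`a^s·(2·ζ_H(s-2,3/2) − (1/2)·ζ_H(s,3/2))`. -/
theorem stmt3 (a : ℝ) (ha : 0 < a) (s : ℂ) (hs : 3 < s.re) :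
    Summable (fun n : ℕ+ =>
      ‖(2 * (n : ℂ) * ((n : ℂ) + 1)) * (((((n : ℕ) : ℝ) + 1 / 2) / a : ℝ) : ℂ) ^ (-s)‖) ∧
    HasSum (fun n : ℕ+ =>
        (2 * (n : ℂ) * ((n : ℂ) + 1)) * (((((n : ℕ) : ℝ) + 1 / 2) / a : ℝ) : ℂ) ^ (-s))
      ((a : ℂ) ^ s * (2 * hurwitzZeta32 (s - 2) - (1 / 2) * hurwitzZeta32 s)) := by
  have h1 := hz32_hasSum s (by linarith)
  have h2 := hz32_hasSum (s - 2) (by simp; linarith)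
  have h3 := ((h2.mul_left 2).sub (h1.mul_left (1 / 2))).mul_left ((a : ℂ) ^ s)
  have key : HasSum (fun n : ℕ+ =>
        (2 * (n : ℂ) * ((n : ℂ) + 1)) * (((((n : ℕ) : ℝ) + 1 / 2) / a : ℝ) : ℂ) ^ (-s))
      ((a : ℂ) ^ s * (2 * hurwitzZeta32 (s - 2) - (1 / 2) * hurwitzZeta32 s)) := by
    rw [← Equiv.pnatEquivNat.symm.hasSum_iff]
    convert! h3 using 1
    funext n
    rw [← term_eq a ha s n]
    simp [Equiv.pnatEquivNat]
  exact ⟨key.summable.norm, key⟩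
end

section
/- Let γ : ℕ → ℝ be the sequence defined by γ_1 = 7/3, γ_2 = 235/9, and γ_{n+2} = (22/3)·γ_{n+1} + 5·γ_n for all n ≥ 1, and let N_n = 6·5^{n-1}. Then the limit lim_{n→∞} log(N_n) / log(γ_n / N_n) exists and equals log 5 / log((11+√166)/15). -/
open Filter

/-- The average-curvature approximation to the packing constant of the Apollonian packing
of 3-spheres: with `N_n = 6·5^{n−1}` spheres at level `n` and total curvatures `γ_n`
satisfying `γ_1 = 7/3`, `γ_2 = 235/9`, `γ_{n+2} = (22/3)γ_{n+1} + 5γ_n` (n ≥ 1), the limit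
`lim_n log(N_n)/log(γ_n/N_n)` exists and equals `log 5 / log((11+√166)/15)`. -/
theorem stmt7 (γ : ℕ → ℝ) (h1 : γ 1 = 7 / 3) (h2 : γ 2 = 235 / 9)
    (hrec : ∀ n, 1 ≤ n → γ (n + 2) = (22 / 3) * γ (n + 1) + 5 * γ n) :
    Tendsto
      (fun n : ℕ =>
        Real.log (6 * 5 ^ (n - 1)) / Real.log (γ n / (6 * 5 ^ (n - 1))))
      atTop (nhds (Real.log 5 / Real.log ((11 + Real.sqrt 166) / 15))) := by
  set s := Real.sqrt 166 with hs
  have hs2 : s * s = 166 := Real.mul_self_sqrt (by norm_num)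
  have hs0 : 0 ≤ s := Real.sqrt_nonneg _
  have hslo : 12 < s := by nlinarith
  have hshi : s < 13 := by nlinarith
  set r := (11 + s) / 15 with hr
  have hr1 : 1 < r := by rw [hr]; linarith
  have hr0 : 0 < r := by linarith
  have hL : 0 < Real.log r := Real.log_pos hr1
  have hr2 : 25 * r ^ 2 = (22 / 3) * (5 * r) + 5 := by
    rw [hr]; nlinarith
  -- two-sided geometric bounds
  have key : ∀ m : ℕ, ((5 * r) ^ m ≤ γ (m + 1) ∧ γ (m + 1) ≤ 4 * (5 * r) ^ m) ∧
      ((5 * r) ^ (m + 1) ≤ γ (m + 2) ∧ γ (m + 2) ≤ 4 * (5 * r) ^ (m + 1)) := by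
    intro m
    induction m with
    | zero =>
      simp only [zero_add, pow_zero, pow_one, h1, h2]
      refine ⟨⟨by norm_num, by norm_num⟩, ?_, ?_⟩ <;> rw [hr] <;> linarith
    | succ k ih =>
      obtain ⟨⟨a, b⟩, c, d⟩ := ih
      refine ⟨⟨c, d⟩, ?_⟩
      have e := hrec (k + 1) (by omega)
      have f : (5 * r) ^ (k + 1 + 1) = (22 / 3) * (5 * r) ^ (k + 1) + 5 * (5 * r) ^ k := by
        have : (5 * r) ^ (k + 1 + 1) = (25 * r ^ 2) * (5 * r) ^ k := by ring
        rw [this, hr2]; ring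
      have e' : γ (k + 1 + 2) = (22 / 3) * γ (k + 2) + 5 * γ (k + 1) := e
      rw [e', f]
      constructor <;> linarith
  have hden : ∀ m : ℕ, m * Real.log r + Real.log (1 / 6) ≤
        Real.log (γ (m + 1) / (6 * 5 ^ m)) ∧
      Real.log (γ (m + 1) / (6 * 5 ^ m)) ≤ m * Real.log r + Real.log (4 / 6) := by
    intro m
    obtain ⟨⟨a, b⟩, -⟩ := key m
    have hp : 0 < r ^ m := by positivity
    have h5 : (0 : ℝ) < 6 * 5 ^ m := by positivity
    have hg : 0 < γ (m + 1) := lt_of_lt_of_le (by positivity) a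
    rw [← Real.log_pow, ← Real.log_mul hp.ne' (by norm_num),
      ← Real.log_mul hp.ne' (by norm_num)]
    rw [mul_pow] at a b
    constructor
    · apply Real.log_le_log (by positivity)
      rw [le_div_iff₀ h5]; linarith
    · apply Real.log_le_log (by positivity)
      rw [div_le_iff₀ h5]; linarith
  have lin : ∀ A B : ℝ, Tendsto (fun m : ℕ => ((m : ℝ) * A + B) / m) atTop (nhds A) := by
    intro A B
    have h := (tendsto_const_nhds (x := A)).add (tendsto_const_div_atTop_nhds_zero_nat B)
    rw [add_zero] at h
    refine h.congr' ?_
    filter_upwards [eventually_gt_atTop 0] with m hm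
    have : (m : ℝ) ≠ 0 := by positivity
    field_simp
  have hD : Tendsto (fun m : ℕ => Real.log (γ (m + 1) / (6 * 5 ^ m)) / m) atTop
      (nhds (Real.log r)) := by
    refine tendsto_of_tendsto_of_tendsto_of_le_of_le (lin _ (Real.log (1 / 6)))
      (lin _ (Real.log (4 / 6))) (fun m => ?_) (fun m => ?_)
    · exact div_le_div_of_nonneg_right (hden m).1 (Nat.cast_nonneg m)
    · exact div_le_div_of_nonneg_right (hden m).2 (Nat.cast_nonneg m)
  have hN : Tendsto (fun m : ℕ => Real.log (6 * 5 ^ m) / m) atTop (nhds (Real.log 5)) := by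
    refine (lin (Real.log 5) (Real.log 6)).congr (fun m => ?_)
    rw [Real.log_mul (by norm_num) (by positivity), Real.log_pow, add_comm]
  rw [← tendsto_add_atTop_iff_nat 1]
  refine (hN.div hD hL.ne').congr' ?_
  filter_upwards [eventually_gt_atTop 0] with m hm
  have : (m : ℝ) ≠ 0 := by positivity
  simp only [Pi.div_apply, Nat.add_sub_cancel]
  exact div_div_div_cancel_right₀ this _ _
end

section
/- Let a > 1 and b > 1 be real numbers. Then the set {s ∈ ℂ : a·b^{-s} = 1} equals {log a/log b + 2πim/log b : m ∈ ℤ}. Moreover, for every m ∈ ℤ, setting s_m = log a/log b + 2πim/log b, the limit of (s − s_m)·(1 − a·b^{-s})^{-1} as s → s_m with s ≠ s_m equals 1/log b; that is, each pole of (1 − a·b^{-s})^{-1} is simple with residue 1/log b. -/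
open Complex Topology Filter

/-- The poles of `(1 − a·b^{-s})⁻¹` are exactly the points
`s_m = log a/log b + 2πim/log b`, `m ∈ ℤ`, and each is a simple pole with residue
`1/log b`. -/
theorem stmt9 (a b : ℝ) (ha : 1 < a) (hb : 1 < b) :
    {s : ℂ | (a : ℂ) * (b : ℂ) ^ (-s) = 1} =
      {s : ℂ | ∃ m : ℤ,
        s = ((Real.log a / Real.log b : ℝ) : ℂ) +
          2 * (Real.pi : ℂ) * Complex.I * (m : ℂ) / ((Real.log b : ℝ) : ℂ)} ∧
    ∀ m : ℤ,
      Tendsto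
        (fun s : ℂ =>
          (s - (((Real.log a / Real.log b : ℝ) : ℂ) +
              2 * (Real.pi : ℂ) * Complex.I * (m : ℂ) / ((Real.log b : ℝ) : ℂ))) *
            (1 - (a : ℂ) * (b : ℂ) ^ (-s))⁻¹)
        (𝓝[≠] (((Real.log a / Real.log b : ℝ) : ℂ) +
          2 * (Real.pi : ℂ) * Complex.I * (m : ℂ) / ((Real.log b : ℝ) : ℂ)))
        (𝓝 ((1 / Real.log b : ℝ) : ℂ)) := by
  have hLb : (Real.log b : ℂ) ≠ 0 := by
    exact_mod_cast (Real.log_pos hb).ne'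
  have key : ∀ s : ℂ, (a : ℂ) * (b : ℂ) ^ (-s) =
      Complex.exp ((Real.log a : ℂ) - (Real.log b : ℂ) * s) := by
    intro s
    have hb0 : (b : ℂ) ≠ 0 := by exact_mod_cast (by linarith : b ≠ 0)
    have h1 : (a : ℂ) = Complex.exp (Real.log a : ℂ) := by
      rw [← Complex.ofReal_exp, Real.exp_log (by linarith)]
    rw [Complex.cpow_def_of_ne_zero hb0, ← Complex.ofReal_log (by linarith), sub_eq_add_neg,
      Complex.exp_add, ← h1, mul_neg]
  have hset : {s : ℂ | (a : ℂ) * (b : ℂ) ^ (-s) = 1} =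
      {s : ℂ | ∃ m : ℤ,
        s = ((Real.log a / Real.log b : ℝ) : ℂ) +
          2 * (Real.pi : ℂ) * Complex.I * (m : ℂ) / ((Real.log b : ℝ) : ℂ)} := by
    ext s
    simp only [Set.mem_ofPred_eq, key, Complex.exp_eq_one_iff, Complex.ofReal_div]
    constructor
    · rintro ⟨n, hn⟩
      refine ⟨-n, ?_⟩
      push_cast
      field_simp
      linear_combination -hn
    · rintro ⟨n, rfl⟩
      refine ⟨-n, ?_⟩
      push_cast
      field_simp
      ring
  refine ⟨hset, fun m => ?_⟩
  generalize hs : ((Real.log a / Real.log b : ℝ) : ℂ) +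
          2 * (Real.pi : ℂ) * Complex.I * (m : ℂ) / ((Real.log b : ℝ) : ℂ) = z
  have hz : (a : ℂ) * (b : ℂ) ^ (-z) = 1 := by
    have : z ∈ {s : ℂ | (a : ℂ) * (b : ℂ) ^ (-s) = 1} := by
      rw [hset]
      exact ⟨m, hs.symm⟩
    exact this
  simp only [key] at hz ⊢
  have hd : HasDerivAt (fun s : ℂ => 1 - Complex.exp ((Real.log a : ℂ) - (Real.log b : ℂ) * s))
      (Real.log b : ℂ) z := by
    have h := ((((hasDerivAt_id z).const_mul (Real.log b : ℂ)).const_sub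
      (Real.log a : ℂ)).cexp).const_sub 1
    simp only [id] at h
    rw [hz] at h
    have e : (Real.log b : ℂ) = -(1 * -((Real.log b : ℂ) * 1)) := by ring
    exact h.congr_deriv e.symm
  have ht := (hasDerivAt_iff_tendsto_slope.mp hd).inv₀ hLb
  have he : ((1 / Real.log b : ℝ) : ℂ) = (Real.log b : ℂ)⁻¹ := by
    push_cast
    rw [one_div]
  rw [he]
  refine ht.congr fun s => ?_
  rw [slope_def_field, hz, sub_self, sub_zero, inv_div, div_eq_mul_inv]
end

section
/- Let b > 1 and σ > 0 be real numbers and let f : ℝ → ℂ be a Schwartz function. Then the function F : ℝ → ℂ defined by F(λ) = f(b^λ)·b^{σλ} is a Schwartz function. -/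
/-- The function `x ↦ f(e^{cx}) e^{cσx}`. -/
noncomputable def auxF (c σ : ℝ) (f : SchwartzMap ℝ ℂ) (x : ℝ) : ℂ :=
  f (Real.exp (c * x)) * ((Real.exp (c * σ * x) : ℝ) : ℂ)

lemma auxF_contDiff (c σ : ℝ) (f : SchwartzMap ℝ ℂ) (n : ℕ∞) : ContDiff ℝ n (auxF c σ f) := by
  unfold auxF
  have h0 (a : ℝ) : ContDiff ℝ n (fun x : ℝ => Real.exp (a * x)) := by fun_prop
  have h1 : ContDiff ℝ n (fun x : ℝ => f (Real.exp (c * x))) :=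
    (f.smooth n).comp (by fun_prop)
  have h2 : ContDiff ℝ n (fun x : ℝ => ((Real.exp (c * σ * x) : ℝ) : ℂ)) :=
    Complex.ofRealCLM.contDiff.comp (h0 (c * σ))
  exact h1.mul h2

lemma auxF_deriv (c σ : ℝ) (f : SchwartzMap ℝ ℂ) :
    deriv (auxF c σ f) =
      c • auxF c (σ + 1) (SchwartzMap.derivCLM ℝ ℂ f) + (c * σ) • auxF c σ f := by
  funext x
  have h1 : HasDerivAt (fun x : ℝ => Real.exp (c * x)) (Real.exp (c * x) * c) x := by
    simpa using ((hasDerivAt_id x).const_mul c).exp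
  have h2 : HasDerivAt (fun x : ℝ => Real.exp (c * σ * x)) (Real.exp (c * σ * x) * (c * σ)) x := by
    simpa using ((hasDerivAt_id x).const_mul (c * σ)).exp
  have h3 := (f.differentiableAt (x := Real.exp (c * x))).hasDerivAt.scomp x h1
  have h4 := h3.mul h2.ofReal_comp
  have h5 : HasDerivAt (auxF c σ f) _ x := h4
  rw [h5.deriv]
  have e : Real.exp (c * (σ + 1) * x) = Real.exp (c * x) * Real.exp (c * σ * x) := by
    rw [← Real.exp_add]; ring_nf
  simp only [auxF, Pi.add_apply, Pi.smul_apply, SchwartzMap.derivCLM_apply, e,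
    Complex.real_smul, Function.comp]
  push_cast
  ring

lemma auxF_base (c σ : ℝ) (hc : 0 < c) (hσ : 0 < σ) (f : SchwartzMap ℝ ℂ) (k : ℕ) :
    ∃ C, ∀ x : ℝ, |x| ^ k * ‖auxF c σ f x‖ ≤ C := by
  obtain ⟨N, hN⟩ := exists_nat_ge (2 * σ)
  obtain ⟨C0, h0⟩ := f.decay 0 0
  obtain ⟨C1, h1⟩ := f.decay N 0
  obtain ⟨hC0, h0⟩ := h0
  obtain ⟨hC1, h1⟩ := h1
  have hcs : 0 < c * σ := mul_pos hc hσ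
  have key : ∀ x, ‖auxF c σ f x‖ ≤ (C0 + C1) * Real.exp (-(c * σ * |x|)) := by
    intro x
    have hn : ‖auxF c σ f x‖ = ‖f (Real.exp (c * x))‖ * Real.exp (c * σ * x) := by
      simp [auxF, -Complex.ofReal_exp, abs_of_pos (Real.exp_pos _)]
    have a0 := h0 (Real.exp (c * x))
    have a1 := h1 (Real.exp (c * x))
    simp only [pow_zero, one_mul, norm_iteratedFDeriv_zero] at a0 a1
    rw [Real.norm_of_nonneg (Real.exp_pos _).le, ← Real.exp_nat_mul] at a1
    rw [hn]
    rcases le_total x 0 with hx | hx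
    · rw [abs_of_nonpos hx, show -(c * σ * -x) = c * σ * x by ring]
      gcongr
      linarith
    · rw [abs_of_nonneg hx]
      have e : Real.exp (c * σ * x) ≤ Real.exp (N * (c * x)) * Real.exp (-(c * σ * x)) := by
        rw [← Real.exp_add]
        apply Real.exp_le_exp.2
        nlinarith [mul_le_mul_of_nonneg_right hN (mul_nonneg hc.le hx)]
      calc _ ≤ ‖f (Real.exp (c * x))‖ * (Real.exp (N * (c * x)) * Real.exp (-(c * σ * x))) := by
            gcongr
        _ = (Real.exp (N * (c * x)) * ‖f (Real.exp (c * x))‖) * Real.exp (-(c * σ * x)) := by ring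
        _ ≤ _ := by
            gcongr
            linarith
  refine ⟨(C0 + C1) * (k.factorial / (c * σ) ^ k), fun x => ?_⟩
  have hp := Real.pow_div_factorial_le_exp (c * σ * |x|) (by positivity) k
  have hq : |x| ^ k * Real.exp (-(c * σ * |x|)) ≤ k.factorial / (c * σ) ^ k := by
    rw [Real.exp_neg, ← div_eq_mul_inv, div_le_div_iff₀ (Real.exp_pos _) (by positivity)]
    rw [div_le_iff₀ (by positivity), mul_pow] at hp
    linarith
  calc _ ≤ |x| ^ k * ((C0 + C1) * Real.exp (-(c * σ * |x|))) := by gcongr; exact key x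
    _ = (C0 + C1) * (|x| ^ k * Real.exp (-(c * σ * |x|))) := by ring
    _ ≤ _ := by gcongr

lemma auxF_decay (c : ℝ) (hc : 0 < c) (k n : ℕ) : ∀ (σ : ℝ) (_ : 0 < σ) (f : SchwartzMap ℝ ℂ),
    ∃ C, ∀ x : ℝ, |x| ^ k * ‖iteratedDeriv n (auxF c σ f) x‖ ≤ C := by
  induction n with
  | zero =>
    intro σ hσ f
    simpa using auxF_base c σ hc hσ f k
  | succ n ih =>
    intro σ hσ f
    obtain ⟨A, hA⟩ := ih (σ + 1) (by linarith) (SchwartzMap.derivCLM ℝ ℂ f)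
    obtain ⟨B, hB⟩ := ih σ hσ f
    refine ⟨c * A + c * σ * B, fun x => ?_⟩
    have s1 := (auxF_contDiff c (σ + 1) (SchwartzMap.derivCLM ℝ ℂ f) n).contDiffAt (x := x)
    have s2 := (auxF_contDiff c σ f n).contDiffAt (x := x)
    have t1 : ContDiffAt ℝ n (c • auxF c (σ + 1) (SchwartzMap.derivCLM ℝ ℂ f)) x :=
      contDiffAt_const.smul s1
    have t2 : ContDiffAt ℝ n ((c * σ) • auxF c σ f) x := contDiffAt_const.smul s2
    rw [iteratedDeriv_succ', auxF_deriv, iteratedDeriv_add t1 t2,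
      iteratedDeriv_const_smul s1, iteratedDeriv_const_smul s2]
    have hcs : 0 < c * σ := mul_pos hc hσ
    calc _ ≤ |x| ^ k * (c * ‖iteratedDeriv n (auxF c (σ + 1) (SchwartzMap.derivCLM ℝ ℂ f)) x‖
            + c * σ * ‖iteratedDeriv n (auxF c σ f) x‖) := by
          gcongr
          refine (norm_add_le _ _).trans (le_of_eq ?_)
          rw [norm_smul, norm_smul, Real.norm_of_nonneg hc.le, Real.norm_of_nonneg hcs.le]
      _ = c * (|x| ^ k * ‖iteratedDeriv n (auxF c (σ + 1) (SchwartzMap.derivCLM ℝ ℂ f)) x‖)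
            + c * σ * (|x| ^ k * ‖iteratedDeriv n (auxF c σ f) x‖) := by ring
      _ ≤ _ := by
          gcongr
          · exact hA x
          · exact hB x

/-- If `f` is a Schwartz function on `ℝ`, `b > 1` and `σ > 0`, then
`λ ↦ f(b^λ)·b^{σλ}` is again a Schwartz function. -/
theorem stmt10 (b σ : ℝ) (hb : 1 < b) (hσ : 0 < σ) (f : SchwartzMap ℝ ℂ) :
    ∃ F : SchwartzMap ℝ ℂ,
      ∀ lam : ℝ, F lam = f (b ^ lam) * ((b ^ (σ * lam) : ℝ) : ℂ) := by
  have hc : 0 < Real.log b := Real.log_pos hb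
  refine ⟨⟨auxF (Real.log b) σ f, auxF_contDiff _ _ _ _, fun k n => ?_⟩, fun x => ?_⟩
  · obtain ⟨C, hC⟩ := auxF_decay _ hc k n σ hσ f
    refine ⟨C, fun x => ?_⟩
    rw [norm_iteratedFDeriv_eq_norm_iteratedDeriv]
    exact hC x
  · change auxF (Real.log b) σ f x = _
    have hb0 : 0 < b := by linarith
    rw [auxF, Real.rpow_def_of_pos hb0, Real.rpow_def_of_pos hb0, mul_assoc]
end

section
/- Let a > 1 and b > 1 be real numbers, set σ = log a/log b, and for m ∈ ℤ set s_m = σ + 2πim/log b. Let f : ℝ → ℂ be a Schwartz function and Λ > 0. Then both of the following families are absolutely summable and the sums are equal: Σ_{n∈ℤ} a^n·f(b^n/Λ) = Λ^σ · Σ_{m∈ℤ} f_{s_m} · e^{2πim·(log Λ/log b)}, where f_{s_m} := (1/log b)·∫_0^∞ f(u)·u^{s_m − 1} du. -/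
open Complex

/-- The point `s_m = σ + 2πim/log b` of the dimension spectrum, where
`σ = log a/log b`. -/
noncomputable def smPole (a b : ℝ) (m : ℤ) : ℂ :=
  ((Real.log a / Real.log b : ℝ) : ℂ) +
    2 * (Real.pi : ℂ) * Complex.I * (m : ℂ) / ((Real.log b : ℝ) : ℂ)

/-- The Fourier coefficient `f_{s_m} = (1/log b)·∫_0^∞ f(u)·u^{s_m−1} du`. -/
noncomputable def fsm (a b : ℝ) (f : SchwartzMap ℝ ℂ) (m : ℤ) : ℂ :=
  ((1 / Real.log b : ℝ) : ℂ) * ∫ u in Set.Ioi (0 : ℝ), f u * (u : ℂ) ^ (smPole a b m - 1)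

/-- The function `exp(-c x) f(exp(-L x))` on the line. -/
noncomputable def auxH (c L : ℝ) (f : SchwartzMap ℝ ℂ) (x : ℝ) : ℂ :=
  ((Real.exp (-(c * x)) : ℝ) : ℂ) * f (Real.exp (-(L * x)))

theorem auxH_hasDerivAt (c L : ℝ) (f : SchwartzMap ℝ ℂ) (x : ℝ) :
    HasDerivAt (auxH c L f)
      (-(c : ℂ) * auxH c L f x + -(L : ℂ) * auxH (c + L) L (SchwartzMap.derivCLM ℝ ℂ f) x) x := by
  have h1 (k : ℝ) : HasDerivAt (fun x : ℝ => Real.exp (-(k * x))) (Real.exp (-(k * x)) * -(k * 1)) x :=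
    (((hasDerivAt_id x).const_mul k).neg).exp
  have h2 := (f.hasDerivAt (Real.exp (-(L * x)))).scomp x (h1 L)
  have h3 := (h1 c).ofReal_comp.mul h2
  refine h3.congr_deriv ?_
  simp only [auxH, SchwartzMap.derivCLM_apply, Complex.real_smul, Function.comp]
  rw [show -((c + L) * x) = -(c * x) + -(L * x) by ring, Real.exp_add]
  push_cast
  ring

theorem auxH_bound (c L : ℝ) (hc : 0 < c) (hL : 0 < L) (f : SchwartzMap ℝ ℂ) :
    ∃ C : ℝ, 0 < C ∧ ∀ x, ‖auxH c L f x‖ ≤ C * (1 + x ^ 2)⁻¹ := by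
  obtain ⟨k, hk⟩ := exists_nat_ge (2 * c / L)
  rw [div_le_iff₀ hL] at hk
  obtain ⟨C0, hC0, h0⟩ := f.decay 0 0
  obtain ⟨C1, hC1, h1⟩ := f.decay k 0
  simp only [norm_iteratedFDeriv_zero, pow_zero, one_mul] at h0 h1
  have key : ∀ x, ‖auxH c L f x‖ ≤ (C0 + C1) * Real.exp (-(c * |x|)) := by
    intro x
    have hn : ‖auxH c L f x‖ = Real.exp (-(c * x)) * ‖f (Real.exp (-(L * x)))‖ := by
      rw [auxH, norm_mul, Complex.norm_real, Real.norm_eq_abs, Real.abs_exp]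
    rw [hn]
    rcases le_total 0 x with hx | hx
    · rw [abs_of_nonneg hx, mul_comm]
      gcongr
      linarith [h0 (Real.exp (-(L * x)))]
    · rw [abs_of_nonpos hx]
      have h := h1 (Real.exp (-(L * x)))
      rw [Real.norm_eq_abs, Real.abs_exp, ← Real.exp_nat_mul] at h
      have h2 : Real.exp (-(c * x)) ≤ Real.exp (-(c * -x)) * Real.exp (k * -(L * x)) := by
        rw [← Real.exp_add]
        apply Real.exp_le_exp.mpr
        nlinarith
      calc Real.exp (-(c * x)) * ‖f (Real.exp (-(L * x)))‖
          ≤ (Real.exp (-(c * -x)) * Real.exp (k * -(L * x))) * ‖f (Real.exp (-(L * x)))‖ := by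
            gcongr
        _ = Real.exp (-(c * -x)) * (Real.exp (k * -(L * x)) * ‖f (Real.exp (-(L * x)))‖) := by ring
        _ ≤ Real.exp (-(c * -x)) * (C0 + C1) := by gcongr; linarith
        _ = _ := by ring
  refine ⟨(C0 + C1) * (1 + 2 / c ^ 2), by positivity, fun x => (key x).trans ?_⟩
  rw [mul_assoc]
  gcongr
  have hq := Real.quadratic_le_exp_of_nonneg (x := c * |x|) (by positivity)
  rw [mul_pow, sq_abs] at hq
  rw [Real.exp_neg, ← div_eq_mul_inv, inv_le_comm₀ (by positivity) (by positivity), inv_div,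
    div_le_iff₀ (by positivity)]
  have hcx : 0 ≤ c * |x| := by positivity
  have hq' : 1 + c ^ 2 * x ^ 2 / 2 ≤ Real.exp (c * |x|) := by linarith
  calc 1 + x ^ 2 ≤ (1 + c ^ 2 * x ^ 2 / 2) * (1 + 2 / c ^ 2) := by
        have : (1 + c ^ 2 * x ^ 2 / 2) * (1 + 2 / c ^ 2)
          = 1 + x ^ 2 + (2 / c ^ 2 + c ^ 2 * x ^ 2 / 2) := by field_simp; ring
        rw [this]
        have : 0 ≤ 2 / c ^ 2 + c ^ 2 * x ^ 2 / 2 := by positivity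
        linarith
    _ ≤ _ := by gcongr

theorem auxH_continuous (c L : ℝ) (f : SchwartzMap ℝ ℂ) : Continuous (auxH c L f) :=
  continuous_iff_continuousAt.mpr fun x => (auxH_hasDerivAt c L f x).continuousAt

theorem auxH_integrable (c L : ℝ) (hc : 0 < c) (hL : 0 < L) (f : SchwartzMap ℝ ℂ) :
    MeasureTheory.Integrable (auxH c L f) := by
  obtain ⟨C, _, h⟩ := auxH_bound c L hc hL f
  exact (integrable_inv_one_add_sq.const_mul C).mono' (auxH_continuous c L f).aestronglyMeasurable
    (Filter.Eventually.of_forall h)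

theorem aux_summable (g : ℤ → ℂ) (C : ℝ) (h : ∀ n : ℤ, (1 + (n : ℝ) ^ 2) * ‖g n‖ ≤ C) :
    Summable (fun n => ‖g n‖) := by
  refine Summable.of_norm_bounded_eventually
    ((Real.summable_one_div_int_pow (p := 2)).mpr one_lt_two |>.mul_left C) ?_
  filter_upwards [(Set.finite_singleton (0 : ℤ)).compl_mem_cofinite] with n hn
  have hn' : (n : ℝ) ≠ 0 := by exact_mod_cast hn
  rw [norm_norm, mul_one_div, le_div_iff₀ (by positivity)]
  nlinarith [h n, norm_nonneg (g n)]

open MeasureTheory FourierTransform in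
theorem auxH_fourier_bound (c L : ℝ) (hc : 0 < c) (hL : 0 < L) (f : SchwartzMap ℝ ℂ) :
    ∃ C : ℝ, ∀ x : ℝ, (1 + x ^ 2) * ‖𝓕 (auxH c L f) x‖ ≤ C := by
  have hd (c : ℝ) (f : SchwartzMap ℝ ℂ) := fun x => (auxH_hasDerivAt c L f x)
  have e1 : deriv (auxH c L f) = fun x => -(c : ℂ) * auxH c L f x +
      -(L : ℂ) * auxH (c + L) L (SchwartzMap.derivCLM ℝ ℂ f) x :=
    funext fun x => (hd c f x).deriv
  have hd2 := fun x => ((hd c f x).const_mul (-(c : ℂ))).add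
    ((hd (c + L) (SchwartzMap.derivCLM ℝ ℂ f) x).const_mul (-(L : ℂ)))
  have i0 := fun f => auxH_integrable c L hc hL f
  have i1 := fun f => auxH_integrable (c + L) L (by positivity) hL f
  have i2 := fun f => auxH_integrable (c + L + L) L (by positivity) hL f
  have I1 : Integrable (deriv (auxH c L f)) := by
    rw [e1]
    exact ((i0 _).const_mul _).add ((i1 _).const_mul _)
  have D1 : Differentiable ℝ (deriv (auxH c L f)) := by
    rw [e1]
    exact fun x => (hd2 x).differentiableAt
  have I2 : Integrable (deriv (deriv (auxH c L f))) := by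
    have e2 := funext fun x => (hd2 x).deriv
    rw [e1]
    refine Integrable.congr ?_ (Filter.EventuallyEq.of_eq e2.symm)
    exact ((((i0 _).const_mul _).add ((i1 _).const_mul _)).const_mul _).add
      ((((i1 _).const_mul _).add ((i2 _).const_mul _)).const_mul _)
  have F1 := Real.fourier_deriv (i0 f) (fun x => (hd c f x).differentiableAt) I1
  have F2 := Real.fourier_deriv I1 D1 I2
  have B (g : ℝ → ℂ) (x : ℝ) : ‖𝓕 g x‖ ≤ ∫ v, ‖g v‖ :=
    VectorFourier.norm_fourierIntegral_le_integral_norm _ _ _ g x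
  refine ⟨(∫ v, ‖auxH c L f v‖) + ∫ v, ‖deriv (deriv (auxH c L f)) v‖, fun x => ?_⟩
  have b0 := B (auxH c L f) x
  have b2 := B (deriv (deriv (auxH c L f))) x
  rw [F2, F1] at b2
  have hn : ‖(2 * Real.pi * Complex.I * x : ℂ)‖ = 2 * Real.pi * |x| := by
    simp [abs_of_pos Real.pi_pos]
  simp only [norm_smul, hn] at b2
  have hp : 1 ≤ 2 * Real.pi := by linarith [Real.pi_gt_three]
  have : x ^ 2 * ‖𝓕 (auxH c L f) x‖ ≤
      2 * Real.pi * |x| * (2 * Real.pi * |x| * ‖𝓕 (auxH c L f) x‖) := by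
    rw [← sq_abs, ← mul_assoc]
    gcongr
    have : 0 ≤ |x| := abs_nonneg x
    have : |x| ≤ 2 * Real.pi * |x| := by nlinarith
    nlinarith
  linarith

open MeasureTheory FourierTransform in
theorem fsm_eq_fourier (a b : ℝ) (hb : 1 < b) (f : SchwartzMap ℝ ℂ) (m : ℤ) :
    fsm a b f m = 𝓕 (auxH (Real.log a) (Real.log b) f) (m : ℝ) := by
  have hL : 0 < Real.log b := Real.log_pos hb
  have h1 : ∫ u in Set.Ioi (0 : ℝ), f u * (u : ℂ) ^ (smPole a b m - 1)
      = mellin f (smPole a b m) := by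
    simp only [mellin, smul_eq_mul, mul_comm]
  have hre : (smPole a b m).re = Real.log a / Real.log b := by
    rw [smPole, show (2 * (Real.pi : ℂ) * Complex.I * (m : ℂ) / ((Real.log b : ℝ) : ℂ)) =
      ((2 * Real.pi * m / Real.log b : ℝ) : ℂ) * Complex.I by push_cast; ring]
    simp only [Complex.add_re, Complex.ofReal_re, Complex.re_ofReal_mul, Complex.I_re]
    ring
  have him : (smPole a b m).im = 2 * Real.pi * m / Real.log b := by
    rw [smPole, show (2 * (Real.pi : ℂ) * Complex.I * (m : ℂ) / ((Real.log b : ℝ) : ℂ)) =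
      ((2 * Real.pi * m / Real.log b : ℝ) : ℂ) * Complex.I by push_cast; ring]
    simp only [Complex.add_im, Complex.ofReal_im, Complex.im_ofReal_mul, Complex.I_im]
    ring
  rw [fsm, h1, mellin_eq_fourier, hre, him, Real.fourier_real_eq_integral_exp_smul,
    Real.fourier_real_eq_integral_exp_smul]
  have := Measure.integral_comp_mul_left (fun v : ℝ => 
    Complex.exp (↑(-2 * Real.pi * v * (2 * Real.pi * m / Real.log b / (2 * Real.pi))) * Complex.I) •
      Real.exp (-(Real.log a / Real.log b) * v) • f (Real.exp (-v))) (Real.log b)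
  rw [abs_of_pos (by positivity), Complex.real_smul, inv_eq_one_div] at this
  rw [← this]
  congr 1
  ext v
  have hpi := Real.pi_ne_zero
  have e1 : -2 * Real.pi * (Real.log b * v) * (2 * Real.pi * m / Real.log b / (2 * Real.pi))
    = -2 * Real.pi * v * m := by field_simp
  have e2 : -(Real.log a / Real.log b) * (Real.log b * v) = -(Real.log a * v) := by field_simp
  rw [e1, e2, auxH, Complex.real_smul]

/-- Exact log-periodic expansion of the spectral action: for a Schwartz function `f`,
`Σ_{n∈ℤ} a^n f(b^n/Λ) = Λ^σ Σ_{m∈ℤ} f_{s_m} e^{2πim·log Λ/log b}`, both sides being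
absolutely summable. -/
theorem stmt11 (a b : ℝ) (ha : 1 < a) (hb : 1 < b) (f : SchwartzMap ℝ ℂ)
    (Λ : ℝ) (hΛ : 0 < Λ) :
    Summable (fun n : ℤ => ‖((a ^ n : ℝ) : ℂ) * f (b ^ n / Λ)‖) ∧
    Summable (fun m : ℤ => ‖fsm a b f m *
        Complex.exp (2 * (Real.pi : ℂ) * Complex.I * (m : ℂ) *
          ((Real.log Λ / Real.log b : ℝ) : ℂ))‖) ∧
    (∑' n : ℤ, ((a ^ n : ℝ) : ℂ) * f (b ^ n / Λ)) =
      ((Λ ^ (Real.log a / Real.log b) : ℝ) : ℂ) *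
        ∑' m : ℤ, fsm a b f m *
          Complex.exp (2 * (Real.pi : ℂ) * Complex.I * (m : ℂ) *
            ((Real.log Λ / Real.log b : ℝ) : ℂ)) := by
  have hL : 0 < Real.log b := Real.log_pos hb
  have hA : 0 < Real.log a := Real.log_pos ha
  set x₀ : ℝ := Real.log Λ / Real.log b with hx₀
  set G := auxH (Real.log a) (Real.log b) f with hG
  obtain ⟨C, hC, hbd⟩ := auxH_bound _ _ hA hL f
  obtain ⟨C', hF⟩ := auxH_fourier_bound _ _ hA hL f
  have hterm : ∀ n : ℤ, ((a ^ n : ℝ) : ℂ) * f (b ^ n / Λ) =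
      ((Λ ^ (Real.log a / Real.log b) : ℝ) : ℂ) * G (x₀ + ((-n : ℤ) : ℝ)) := by
    intro n
    have ha0 : 0 < a := by linarith
    have hb0 : 0 < b := by linarith
    have e1 : Real.exp (-(Real.log b * (x₀ + ((-n : ℤ) : ℝ)))) = b ^ n / Λ := by
      rw [hx₀, show -(Real.log b * (Real.log Λ / Real.log b + ((-n : ℤ) : ℝ)))
        = Real.log b * n - Real.log Λ by push_cast; field_simp; ring, Real.exp_sub,
        Real.exp_log hΛ, ← Real.rpow_def_of_pos hb0, Real.rpow_intCast]
    have e2 : Λ ^ (Real.log a / Real.log b) * Real.exp (-(Real.log a * (x₀ + ((-n : ℤ) : ℝ))))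
        = a ^ n := by
      rw [hx₀, Real.rpow_def_of_pos hΛ, ← Real.exp_add, ← Real.rpow_intCast,
        Real.rpow_def_of_pos ha0]
      congr 1
      push_cast
      field_simp
      ring
    rw [hG, auxH, e1, ← mul_assoc, ← Complex.ofReal_mul, e2]
  have hS1 : Summable (fun n : ℤ => ‖G (x₀ + (n : ℝ))‖) := by
    refine aux_summable (fun n : ℤ => G (x₀ + (n : ℝ))) ((2 + 2 * x₀ ^ 2) * C) fun n => ?_
    have h := hbd (x₀ + n)
    rw [← div_eq_mul_inv, le_div_iff₀ (by positivity)] at h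
    have h2 : 1 + (n : ℝ) ^ 2 ≤ (2 + 2 * x₀ ^ 2) * (1 + (x₀ + n) ^ 2) := by
      nlinarith [sq_nonneg (2 * x₀ + n), mul_nonneg (sq_nonneg x₀) (sq_nonneg (x₀ + n))]
    calc _ ≤ (2 + 2 * x₀ ^ 2) * (1 + (x₀ + n) ^ 2) * ‖G (x₀ + n)‖ := by gcongr
      _ = (2 + 2 * x₀ ^ 2) * (‖G (x₀ + n)‖ * (1 + (x₀ + n) ^ 2)) := by ring
      _ ≤ _ := by gcongr
  have hS2 : Summable (fun m : ℤ => ‖fsm a b f m‖) :=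
    aux_summable _ C' fun n => by rw [fsm_eq_fourier a b hb]; exact hF n
  have hfou : ∀ m : ℤ, fourier m (x₀ : UnitAddCircle) =
      Complex.exp (2 * (Real.pi : ℂ) * Complex.I * (m : ℂ) * (x₀ : ℂ)) := by
    intro m
    rw [fourier_coe_apply]
    simp
  refine ⟨?_, ?_, ?_⟩
  · simp only [hterm, norm_mul]
    exact ((Equiv.neg ℤ).summable_iff.mpr hS1).mul_left _
  · simp only [← hfou, norm_mul]
    refine hS2.congr fun m => ?_
    rw [fourier_apply, Circle.norm_coe, mul_one]
  · simp only [hterm, ← hfou]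
    rw [tsum_mul_left]
    congr 1
    refine ((Equiv.neg ℤ).tsum_eq (fun n : ℤ => G (x₀ + (n : ℝ)))).trans ?_
    simp only [fsm_eq_fourier a b hb]
    refine Real.tsum_eq_tsum_fourier_of_rpow_decay_of_summable (auxH_continuous _ _ f) one_lt_two
      ?_ ?_ x₀
    · refine Asymptotics.IsBigO.of_bound C ?_
      filter_upwards [(Filter.hasBasis_cocompact.mem_of_mem (isCompact_singleton (x := (0 : ℝ))))]
        with x hx
      have hx' : x ≠ 0 := hx
      refine (hbd x).trans ?_
      have : |x| ^ (-2 : ℝ) = (x ^ 2)⁻¹ := by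
        rw [Real.rpow_neg (abs_nonneg x)]
        norm_num
      rw [this, Real.norm_of_nonneg (by positivity)]
      gcongr
      linarith
    · refine hS2.of_norm.congr fun m => ?_
      rw [fsm_eq_fourier a b hb]
end

section
/- Let d ∈ ℕ, let P be a real polynomial of degree d with C_P the sum of the absolute values of its coefficients, and set f(x) = P(πx²)·e^{-πx²}. Let 0 < γ < 1 and σ > 0, and let Λ > 0 be real with Λ^{2γ} ≥ (d+1)·(1 + log(d+1)). Let I be a finite index set and (a_i)_{i∈I} reals with (3/2)·Λ^{-(1+γ)} ≤ a_i ≤ Λ^{-1+γ} for all i and card(I) ≤ (3/2)^σ·Λ^{(1+γ)σ}. For each i let N_i be the least element of 1/2 + ℤ with N_i ≥ max(Λ^{1+γ}·a_i, 3/2). Then Σ_{i∈I} 2·Σ_{λ ∈ 1/2+ℤ, λ ≥ N_i} (λ² − 1/4)·|f(λ/(Λ·a_i))| ≤ (3/2)^σ·(2/π)·C_P·Λ^{2γ+(1+γ)σ}·(1 + (2/π)·Λ^{2γ})·e^{-πΛ^{2γ}/2}. -/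
open Real Polynomial

lemma aux_log (n u : ℝ) (hn : 1 ≤ n) (hu : π * (n * (1 + Real.log n)) ≤ u) :
    n * Real.log u ≤ u / 2 := by
  have hn0 : 0 < n := by linarith
  have ht : 0 ≤ Real.log n := Real.log_nonneg hn
  have hp : 3 < π := Real.pi_gt_three
  have hu0 : 0 < u := lt_of_lt_of_le (by positivity) hu
  obtain ⟨v, hv⟩ : ∃ v, v = u / n := ⟨_, rfl⟩
  have huv : u = n * v := by rw [hv]; field_simp
  have hv0 : 0 < v := by rw [hv]; positivity
  have hv1 : π * (1 + Real.log n) ≤ v := by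
    rw [hv, le_div_iff₀ hn0]; linarith
  have h3 : 3 * (1 + Real.log n) ≤ v := by nlinarith
  have hl : Real.log v ≤ v / 6 + 1 := by
    have h1 := Real.log_le_sub_one_of_pos (x := v * Real.exp (-2)) (by positivity)
    rw [Real.log_mul hv0.ne' (Real.exp_pos _).ne', Real.log_exp] at h1
    have h2 : Real.exp (-2) ≤ 1 / 6 := by
      have e1 := Real.exp_one_gt_d9
      have e2 : Real.exp 2 = Real.exp 1 * Real.exp 1 := by rw [← Real.exp_add]; norm_num
      rw [Real.exp_neg, inv_eq_one_div]
      apply one_div_le_one_div_of_le (by norm_num)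
      rw [e2]; nlinarith
    nlinarith
  have : Real.log u ≤ v / 2 := by
    rw [huv, Real.log_mul hn0.ne' hv0.ne']; linarith
  calc n * Real.log u ≤ n * (v / 2) := by gcongr
    _ = u / 2 := by rw [huv]; ring

lemma aux_poly (P : Polynomial ℝ) (u : ℝ) (hu : 1 ≤ u) :
    |P.eval u| ≤ (∑ k ∈ Finset.range (P.natDegree + 1), |P.coeff k|) * u ^ P.natDegree := by
  rw [Polynomial.eval_eq_sum_range, Finset.sum_mul]
  refine (Finset.abs_sum_le_sum_abs _ _).trans (Finset.sum_le_sum fun k hk => ?_)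
  rw [abs_mul, abs_of_nonneg (pow_nonneg (by linarith : (0:ℝ) ≤ u) k)]
  have : k ≤ P.natDegree := by have := Finset.mem_range.mp hk; omega
  gcongr

lemma aux_f (P : Polynomial ℝ) (L u : ℝ)
    (hL : ((P.natDegree : ℝ) + 1) * (1 + Real.log ((P.natDegree : ℝ) + 1)) ≤ L) (hL1 : 1 ≤ L)
    (hu : π * L ≤ u) :
    |P.eval u * Real.exp (-u)| ≤
      (∑ k ∈ Finset.range (P.natDegree + 1), |P.coeff k|) / (π * L) * Real.exp (-(u / 2)) := by
  have hp : 3 < π := Real.pi_gt_three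
  have hu1 : 1 ≤ u := by nlinarith
  have hu0 : 0 < u := by linarith
  set C := ∑ k ∈ Finset.range (P.natDegree + 1), |P.coeff k| with hC
  have hC0 : 0 ≤ C := Finset.sum_nonneg fun _ _ => abs_nonneg _
  have h1 := aux_log ((P.natDegree : ℝ) + 1) u (by simp) (le_trans (by gcongr) hu)
  have h2 : u ^ (P.natDegree + 1) ≤ Real.exp (u / 2) := by
    rw [← Real.exp_log hu0, ← Real.exp_nat_mul, Real.exp_log hu0]
    apply Real.exp_le_exp.mpr
    push_cast; exact h1
  have h3 : u ^ P.natDegree ≤ Real.exp (u / 2) / (π * L) := by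
    rw [le_div_iff₀ (by positivity)]
    calc u ^ P.natDegree * (π * L) ≤ u ^ P.natDegree * u := by gcongr
      _ = u ^ (P.natDegree + 1) := by ring
      _ ≤ _ := h2
  rw [abs_mul, abs_of_pos (Real.exp_pos _)]
  calc |P.eval u| * Real.exp (-u) ≤ (C * u ^ P.natDegree) * Real.exp (-u) := by
        gcongr; exact aux_poly P u hu1
    _ ≤ (C * (Real.exp (u / 2) / (π * L))) * Real.exp (-u) := by gcongr
    _ = C / (π * L) * (Real.exp (u / 2) * Real.exp (-u)) := by ring
    _ = _ := by rw [← Real.exp_add]; ring_nf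

lemma aux_mono (x y : ℝ) (hx : 1 ≤ x) (hxy : x ≤ y) :
    y * Real.exp (-y) ≤ x * Real.exp (-x) := by
  have h := Real.add_one_le_exp (y - x)
  have h2 : y ≤ x * Real.exp (y - x) := by nlinarith
  calc y * Real.exp (-y) ≤ (x * Real.exp (y - x)) * Real.exp (-y) := by gcongr
    _ = x * (Real.exp (y - x) * Real.exp (-y)) := by ring
    _ = _ := by rw [← Real.exp_add]; ring_nf

lemma aux_q : 4 * Real.exp (-π) ≤ 1 / 5 := by
  have hp : 3 < π := Real.pi_gt_three
  have e1 := Real.exp_one_gt_d9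
  have e2 : Real.exp 3 = Real.exp 1 * Real.exp 1 * Real.exp 1 := by
    rw [← Real.exp_add, ← Real.exp_add]; norm_num
  have e3 : (20:ℝ) ≤ Real.exp π := by
    calc (20:ℝ) ≤ Real.exp 1 * Real.exp 1 * Real.exp 1 := by
          have : (7.38:ℝ) ≤ Real.exp 1 * Real.exp 1 := by nlinarith
          nlinarith
      _ = Real.exp 3 := e2.symm
      _ ≤ _ := Real.exp_le_exp.mpr hp.le
  have : Real.exp (-π) ≤ 1 / 20 := by
    rw [Real.exp_neg, inv_eq_one_div]
    exact one_div_le_one_div_of_le (by norm_num) e3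
  linarith

/-- termwise Gaussian bound -/
lemma aux_term (M R x : ℝ) (j : ℕ) (hM : 1 ≤ M) (hR : 0 < R) (hRM : R ≤ M)
    (hT : 1 ≤ M * R) (hx : M * R + j ≤ x) :
    x ^ 2 * Real.exp (-(π * (x / R) ^ 2 / 2)) ≤
      M ^ 4 * Real.exp (-(π * M ^ 2 / 2)) * (1 / 5) ^ j := by
  have hp : 3 < π := Real.pi_gt_three
  have hj : (0:ℝ) ≤ j := Nat.cast_nonneg j
  set y := M * R + j with hy
  have hy0 : 0 < y := by positivity
  have hM0 : 0 < M := by linarith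
  have hyR : M ≤ y / R := by rw [le_div_iff₀ hR]; linarith
  have h1 : x ^ 2 * Real.exp (-(π * (x / R) ^ 2 / 2)) ≤
      y ^ 2 * Real.exp (-(π * (y / R) ^ 2 / 2)) := by
    have hm := aux_mono (π * (y / R) ^ 2 / 2) (π * (x / R) ^ 2 / 2)
      (by have : 1 ≤ (y / R) ^ 2 := by nlinarith
          nlinarith) (by gcongr)
    have e : ∀ z : ℝ, z ^ 2 = (2 * R ^ 2 / π) * (π * (z / R) ^ 2 / 2) := by
      intro z; field_simp
    rw [e x, e y, mul_assoc, mul_assoc]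
    exact mul_le_mul_of_nonneg_left hm (by positivity)
  have h2 : y ≤ M * R * 2 ^ j := by
    have : (j:ℝ) + 1 ≤ 2 ^ j := by exact_mod_cast Nat.lt_two_pow_self
    nlinarith
  have h3 : Real.exp (-(π * (y / R) ^ 2 / 2)) ≤
      Real.exp (-(π * M ^ 2 / 2)) * Real.exp (-π) ^ j := by
    rw [← Real.exp_nat_mul, ← Real.exp_add]
    apply Real.exp_le_exp.mpr
    have e : y / R = M + j / R := by rw [hy]; field_simp
    have e2 : 1 ≤ M / R := by rw [le_div_iff₀ hR]; linarith
    have e3 : M ^ 2 + 2 * j ≤ (y / R) ^ 2 := by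
      rw [e]
      have : M * (j / R) = (M / R) * j := by ring
      nlinarith [sq_nonneg ((j:ℝ) / R)]
    nlinarith
  calc _ ≤ _ := h1
    _ ≤ (M * R * 2 ^ j) ^ 2 * (Real.exp (-(π * M ^ 2 / 2)) * Real.exp (-π) ^ j) := by gcongr
    _ = (M * R) ^ 2 * Real.exp (-(π * M ^ 2 / 2)) * (4 * Real.exp (-π)) ^ j := by
        rw [mul_pow 4, show (4:ℝ) = 2 ^ 2 by norm_num, ← pow_mul, mul_comm 2 j, pow_mul]; ring
    _ ≤ (M * M) ^ 2 * Real.exp (-(π * M ^ 2 / 2)) * (1 / 5) ^ j := by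
        gcongr; exact aux_q
    _ = _ := by ring

lemma aux_sphere (P : Polynomial ℝ) (f : ℝ → ℝ)
    (hf : ∀ x : ℝ, f x = P.eval (π * x ^ 2) * Real.exp (-π * x ^ 2)) (M R N : ℝ)
    (hL : ((P.natDegree : ℝ) + 1) * (1 + Real.log ((P.natDegree : ℝ) + 1)) ≤ M ^ 2)
    (hM : 1 ≤ M) (hR : 0 < R) (hRM : R ≤ M) (hT : 1 ≤ M * R) (hN : M * R ≤ N) :
    2 * ∑' j : ℕ, ((N + (j : ℝ)) ^ 2 - 1 / 4) * |f ((N + (j : ℝ)) / R)| ≤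
      (2 / π) * (∑ k ∈ Finset.range (P.natDegree + 1), |P.coeff k|) * M ^ 2 *
        (1 + (2 / π) * M ^ 2) * Real.exp (-π * M ^ 2 / 2) := by
  have hp : 3 < π := Real.pi_gt_three
  set C := ∑ k ∈ Finset.range (P.natDegree + 1), |P.coeff k| with hC
  have hC0 : 0 ≤ C := Finset.sum_nonneg fun _ _ => abs_nonneg _
  have hM0 : 0 < M := by linarith
  have hM2 : 1 ≤ M ^ 2 := by nlinarith
  have ht : ∀ j : ℕ, ((N + (j : ℝ)) ^ 2 - 1 / 4) * |f ((N + (j : ℝ)) / R)| ≤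
      C / (π * M ^ 2) * (M ^ 4 * Real.exp (-(π * M ^ 2 / 2))) * (1 / 5) ^ j := by
    intro j
    have hj : (0:ℝ) ≤ j := Nat.cast_nonneg j
    have hx : M ≤ (N + j) / R := by rw [le_div_iff₀ hR]; linarith
    have h1 := aux_f P (M ^ 2) (π * ((N + j) / R) ^ 2) hL hM2 (by gcongr)
    have h2 := aux_term M R (N + j) j hM hR hRM hT (by linarith)
    rw [hf, neg_mul]
    calc _ ≤ (N + (j:ℝ)) ^ 2 * (C / (π * M ^ 2) *
            Real.exp (-(π * ((N + j) / R) ^ 2 / 2))) := by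
          gcongr
          linarith
      _ = C / (π * M ^ 2) * ((N + (j:ℝ)) ^ 2 * Real.exp (-(π * ((N + j) / R) ^ 2 / 2))) := by ring
      _ ≤ C / (π * M ^ 2) * (M ^ 4 * Real.exp (-(π * M ^ 2 / 2)) * (1 / 5) ^ j) := by gcongr
      _ = _ := by ring
  have h0 : ∀ j : ℕ, 0 ≤ ((N + (j : ℝ)) ^ 2 - 1 / 4) * |f ((N + (j : ℝ)) / R)| := by
    intro j
    have hj : (0:ℝ) ≤ j := Nat.cast_nonneg j
    apply mul_nonneg _ (abs_nonneg _)
    nlinarith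
  have hg : Summable fun j : ℕ => ((1:ℝ) / 5) ^ j :=
    summable_geometric_of_lt_one (by norm_num) (by norm_num)
  have hg2 := hg.mul_left (C / (π * M ^ 2) * (M ^ 4 * Real.exp (-(π * M ^ 2 / 2))))
  have hs := Summable.tsum_le_tsum ht (Summable.of_nonneg_of_le h0 ht hg2) hg2
  rw [tsum_mul_left, tsum_geometric_of_lt_one (by norm_num) (by norm_num)] at hs
  have hk : (5:ℝ) / 4 ≤ 1 + 2 / π * M ^ 2 := by
    have : (1:ℝ) / 4 ≤ 2 / π := by
      rw [div_le_div_iff₀ (by norm_num) (by linarith)]; linarith [Real.pi_le_four]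
    nlinarith
  calc _ ≤ 2 * (C / (π * M ^ 2) * (M ^ 4 * Real.exp (-(π * M ^ 2 / 2))) * (1 - 1 / 5)⁻¹) := by
        gcongr
    _ = 2 / π * C * M ^ 2 * (5 / 4) * Real.exp (-π * M ^ 2 / 2) := by
        rw [show -(π * M ^ 2 / 2) = -π * M ^ 2 / 2 by ring]; field_simp; norm_num
    _ ≤ _ := by gcongr

/-- Tail estimate for the spectral action of the spheres of a packing with radii between
the two fractality cutoff scales `(3/2)Λ^{-(1+γ)}` and `Λ^{-1+γ}`: with
`f(x) = P(πx²)e^{-πx²}`, `deg P = d`, `Λ^{2γ} ≥ (d+1)(1+log(d+1))`, at most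
`(3/2)^σ Λ^{(1+γ)σ}` spheres, and `N_i` the least half-integer
`≥ max(Λ^{1+γ}a_i, 3/2)`, one has
`Σ_i 2Σ_{λ≥N_i}(λ²−1/4)|f(λ/(Λa_i))| ≤ (3/2)^σ(2/π)C_P Λ^{2γ+(1+γ)σ}(1+(2/π)Λ^{2γ})e^{-πΛ^{2γ}/2}`. -/
theorem stmt17 (d : ℕ) (P : Polynomial ℝ) (hPd : P.natDegree = d)
    (f : ℝ → ℝ) (hf : ∀ x : ℝ, f x = P.eval (π * x ^ 2) * Real.exp (-π * x ^ 2))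
    (γ σ : ℝ) (hγ0 : 0 < γ) (hγ1 : γ < 1) (hσ : 0 < σ)
    (Λ : ℝ) (hΛ : 0 < Λ)
    (hΛ2 : ((d : ℝ) + 1) * (1 + Real.log ((d : ℝ) + 1)) ≤ Λ ^ (2 * γ))
    {I : Type*} [Fintype I] (a : I → ℝ)
    (haL : ∀ i, (3 / 2) * Λ ^ (-(1 + γ)) ≤ a i) (haU : ∀ i, a i ≤ Λ ^ (-1 + γ))
    (hcard : (Fintype.card I : ℝ) ≤ (3 / 2) ^ σ * Λ ^ ((1 + γ) * σ))
    (N : I → ℝ)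
    (hNhalf : ∀ i, ∃ k : ℤ, N i = (k : ℝ) + 1 / 2)
    (hNge : ∀ i, max (Λ ^ (1 + γ) * a i) (3 / 2) ≤ N i)
    (hNleast : ∀ i, ∀ N' : ℝ, (∃ k : ℤ, N' = (k : ℝ) + 1 / 2) →
      max (Λ ^ (1 + γ) * a i) (3 / 2) ≤ N' → N i ≤ N') :
    ∑ i, 2 * ∑' j : ℕ, ((N i + (j : ℝ)) ^ 2 - 1 / 4) * |f ((N i + (j : ℝ)) / (Λ * a i))|
      ≤ (3 / 2) ^ σ * (2 / π) *
          (∑ k ∈ Finset.range (P.natDegree + 1), |P.coeff k|) *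
          Λ ^ (2 * γ + (1 + γ) * σ) * (1 + (2 / π) * Λ ^ (2 * γ)) *
          Real.exp (-π * Λ ^ (2 * γ) / 2) := by
  have hn1 : (1:ℝ) ≤ (d:ℝ) + 1 := by simp
  have hL1 : 1 ≤ Λ ^ (2 * γ) := by
    have := Real.log_nonneg hn1
    nlinarith
  have hML : Λ ^ (2 * γ) = (Λ ^ γ) ^ 2 := by
    rw [mul_comm, Real.rpow_mul hΛ.le]; norm_num
  have hMpos : 0 < Λ ^ γ := Real.rpow_pos_of_pos hΛ γ
  have hM1 : 1 ≤ Λ ^ γ := by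
    rw [hML] at hL1; nlinarith
  have key : ∀ i, 2 * ∑' j : ℕ, ((N i + (j : ℝ)) ^ 2 - 1 / 4) *
      |f ((N i + (j : ℝ)) / (Λ * a i))| ≤
      (2 / π) * (∑ k ∈ Finset.range (P.natDegree + 1), |P.coeff k|) * Λ ^ (2 * γ) *
        (1 + (2 / π) * Λ ^ (2 * γ)) * Real.exp (-π * Λ ^ (2 * γ) / 2) := by
    intro i
    have ha0 : 0 < a i := lt_of_lt_of_le (by positivity) (haL i)
    have hTe : Λ ^ (1 + γ) * a i = Λ ^ γ * (Λ * a i) := by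
      rw [Real.rpow_add hΛ, Real.rpow_one]; ring
    have hT : 3 / 2 ≤ Λ ^ (1 + γ) * a i := by
      have h := haL i
      have hpos : 0 < Λ ^ (1 + γ) := Real.rpow_pos_of_pos hΛ _
      rw [Real.rpow_neg hΛ.le, ← div_eq_mul_inv, div_le_iff₀ hpos] at h
      linarith
    have hRM : Λ * a i ≤ Λ ^ γ := by
      have h := mul_le_mul_of_nonneg_left (haU i) hΛ.le
      rwa [Real.rpow_add hΛ, Real.rpow_neg_one, mul_inv_cancel_left₀ hΛ.ne'] at h
    rw [hML]
    refine aux_sphere P f hf (Λ ^ γ) (Λ * a i) (N i) ?_ hM1 (by positivity) hRM ?_ ?_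
    · rw [hPd, ← hML]; exact hΛ2
    · rw [← hTe]; linarith
    · rw [← hTe]; exact (le_max_left _ _).trans (hNge i)
  refine (Finset.sum_le_sum fun i _ => key i).trans ?_
  rw [Finset.sum_const, Finset.card_univ, nsmul_eq_mul, Real.rpow_add hΛ]
  have hC0 : 0 ≤ ∑ k ∈ Finset.range (P.natDegree + 1), |P.coeff k| :=
    Finset.sum_nonneg fun _ _ => abs_nonneg _
  refine (mul_le_mul_of_nonneg_right hcard (by positivity)).trans (le_of_eq ?_)
  ring
end

section
/- Let φ = (1+√5)/2 be the golden ratio and let a > 0 be real. For every complex s with Re(s) > 3, the doubly indexed family ( (1/120)·20^n·2(k+1)(k+2)·((k+3/2)·(2+φ)^n/a)^{-s} )_{(n,k) ∈ ℕ×ℕ} is summable, and its sum equals (a^s/120)·(2·ζ_H(s-2, 3/2) − (1/2)·ζ_H(s, 3/2))·(1 − 20·(2+φ)^{-s})^{-1}. -/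
open Complex

/-- The golden ratio `φ = (1+√5)/2`. -/
noncomputable def goldenRatio' : ℝ := (1 + Real.sqrt 5) / 2

lemma hasSum_transfer {ι : Type} {f g : ι → ℂ} {x y : ℂ} (h : HasSum f x) (hf : ∀ i, g i = f i)
    (hx : y = x) : HasSum g y := by
  have : g = f := funext hf
  rw [this, hx]
  exact h

lemma hasSum_prod_aux {f g : ℕ → ℂ} {x y : ℂ} (c : ℂ) (hf : HasSum f x) (hg : HasSum g y) :
    HasSum (fun p : ℕ × ℕ => c * (f p.1 * g p.2)) (c * (x * y)) := by
  have hsum : Summable (fun p : ℕ × ℕ => f p.1 * g p.2) := summable_mul_of_summable_norm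
    (summable_norm_iff.mpr hf.summable) (summable_norm_iff.mpr hg.summable)
  exact (hf.mul hg hsum).mul_left c

lemma term_aux {a : ℝ} (ha : 0 < a) (s : ℂ) {x g : ℝ} (hx : 0 ≤ x) (hg : 0 < g) (n : ℕ) :
    ((x * g ^ n / a : ℝ) : ℂ) ^ (-s) = (x : ℂ) ^ (-s) * ((g : ℂ) ^ (-s)) ^ n * (a : ℂ) ^ s := by
  have e2 : ((g ^ n : ℝ) : ℂ) ^ (-s) = ((g : ℂ) ^ (-s)) ^ n := by
    induction n with
    | zero => simp
    | succ n ih =>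
      rw [pow_succ, pow_succ, ofReal_mul, mul_cpow_ofReal_nonneg (by positivity) hg.le, ih]
  have e3 : ((a⁻¹ : ℝ) : ℂ) ^ (-s) = (a : ℂ) ^ s := by
    rw [ofReal_inv, inv_cpow, cpow_neg, inv_inv]
    rw [arg_ofReal_of_nonneg ha.le]
    exact Real.pi_pos.ne
  rw [div_eq_mul_inv, ofReal_mul, mul_cpow_ofReal_nonneg (by positivity) (by positivity),
    ofReal_mul, mul_cpow_ofReal_nonneg hx (by positivity), e2, e3]

lemma hasSum_hz32 {s : ℂ} (hs : 1 < s.re) :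
    HasSum (fun k : ℕ => (((k : ℝ) + 3 / 2 : ℝ) : ℂ) ^ (-s)) (hurwitzZeta32 s) := by
  have h := HurwitzZeta.hasSum_hurwitzZeta_of_one_lt_re (a := 1 / 2) (by norm_num) hs
  rw [← hasSum_nat_add_iff' 1] at h
  unfold hurwitzZeta32
  refine hasSum_transfer h ?_ ?_
  · intro k
    rw [cpow_neg, one_div]
    congr 3
    push_cast
    ring
  · congr 1
    simp only [Finset.range_one, Finset.sum_singleton]
    have : ((0 : ℕ) : ℂ) + ((1 / 2 : ℝ) : ℂ) = (((2 : ℝ)⁻¹ : ℝ) : ℂ) := by push_cast; ring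
    rw [this, ofReal_inv, inv_cpow, one_div, inv_inv]
    · simp
    · rw [arg_ofReal_of_nonneg (by norm_num)]
      exact Real.pi_pos.ne

lemma golden_gt : (3 : ℝ) < 2 + goldenRatio' := by
  unfold goldenRatio'
  have : (1 : ℝ) < Real.sqrt 5 := by
    rw [Real.lt_sqrt] <;> norm_num
  linarith

lemma hasSum_k {s : ℂ} (hs : 3 < s.re) :
    HasSum (fun k : ℕ => (2 * ((k : ℂ) + 1) * ((k : ℂ) + 2)) * (((k : ℝ) + 3 / 2 : ℝ) : ℂ) ^ (-s))
      (2 * hurwitzZeta32 (s - 2) - (1 / 2) * hurwitzZeta32 s) := by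
  have h1 := (hasSum_hz32 (s := s - 2) (by simp; linarith)).mul_left 2
  have h2 := (hasSum_hz32 (s := s) (by linarith)).mul_left (1 / 2)
  refine hasSum_transfer (h1.sub h2) ?_ rfl
  intro k
  have hx : (((k : ℝ) + 3 / 2 : ℝ) : ℂ) ≠ 0 := by
    rw [Ne, ofReal_eq_zero]; positivity
  have : -(s - 2) = -s + 2 := by ring
  rw [this, cpow_add _ _ hx, cpow_ofNat]
  push_cast
  ring

lemma geo_norm {s : ℂ} (hs : 3 < s.re) :
    ‖(20 : ℂ) * ((2 + goldenRatio' : ℝ) : ℂ) ^ (-s)‖ < 1 := by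
  have hg := golden_gt
  have h0 : (0 : ℝ) < 2 + goldenRatio' := by linarith
  rw [norm_mul, norm_cpow_eq_rpow_re_of_pos h0, neg_re, Real.rpow_neg h0.le, ← div_eq_mul_inv,
    div_lt_one (by positivity)]
  have h3 : (2 + goldenRatio') ^ (3 : ℝ) < (2 + goldenRatio') ^ s.re :=
    Real.rpow_lt_rpow_of_exponent_lt (by linarith) hs
  have h4 : (3 : ℝ) ^ 3 < (2 + goldenRatio') ^ 3 := by gcongr
  rw [show (3 : ℝ) = ((3 : ℕ) : ℝ) by norm_num, Real.rpow_natCast] at h3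
  norm_num at h4 ⊢
  linarith


/-- The zeta function of the Dirac operator of the fractal arrangement `𝒫_Y` of Poincaré
homology spheres with radii `a·(2+φ)^{-n}` (with `20^n` copies at level `n`): for
`Re s > 3`, the family `(1/120)·20^n·2(k+1)(k+2)·((k+3/2)(2+φ)^n/a)^{-s}` is summable with
sum `(a^s/120)·(2ζ_H(s−2,3/2) − (1/2)ζ_H(s,3/2))·(1 − 20(2+φ)^{-s})⁻¹`. -/
theorem stmt19 (a : ℝ) (ha : 0 < a) (s : ℂ) (hs : 3 < s.re) :
    HasSum (fun p : ℕ × ℕ =>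
        (1 / 120 : ℂ) * (20 : ℂ) ^ p.1 *
          (2 * ((p.2 : ℂ) + 1) * ((p.2 : ℂ) + 2)) *
          (((((p.2 : ℕ) : ℝ) + 3 / 2) * (2 + goldenRatio') ^ p.1 / a : ℝ) : ℂ) ^ (-s))
      ((a : ℂ) ^ s / 120 * (2 * hurwitzZeta32 (s - 2) - (1 / 2) * hurwitzZeta32 s) *
        (1 - 20 * (((2 + goldenRatio' : ℝ)) : ℂ) ^ (-s))⁻¹) := by
  have hg : (0 : ℝ) < 2 + goldenRatio' := by linarith [golden_gt]
  have hG := hasSum_geometric_of_norm_lt_one (geo_norm hs)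
  have hK := hasSum_k hs
  refine hasSum_transfer (hasSum_prod_aux ((a : ℂ) ^ s / 120) hG hK) ?_ ?_
  · intro p
    rw [term_aux ha s (by positivity) hg, mul_pow]
    ring
  · ring
end
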